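/- (Completeness of AutoTight, rank part.) Let 𝒜ₖ be a set of valid constraints for V containing the primary constraints 𝒜ₚ, assume V is nonempty, and assume the set {⟨Q, X⟩ : X ∈ F(𝒜ₖ)} is bounded below. If Xₖ⋆ ∈ F(𝒜ₖ) is an optimal solution, i.e. ⟨Q, Xₖ⋆⟩ = p(𝒜ₖ), with rank(Xₖ⋆) = 1, then Xₖ⋆ also belongs to F(𝒜ₗ) and satisfies ⟨Q, Xₖ⋆⟩ = p(𝒜ₗ) = p(𝒜ₖ) = q⋆; in particular, the SDP with the learned constraints 𝒜ₗ admits a rank-one optimal solution. -/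

import Mathlib

open Matrix

noncomputable section

/-- `A₀ = e₁ e₁ᵀ`, where `e₁` is the first standard basis vector of `ℝ^N`. -/
def A0 (N : ℕ) : Matrix (Fin N) (Fin N) ℝ :=
  Matrix.of fun i j => (if (i : ℕ) = 0 then (1 : ℝ) else 0) * (if (j : ℕ) = 0 then 1 else 0)

/-- The QCQP feasible set `V = {x : xᵀ A₀ x = 1 ∧ ∀ A ∈ 𝒜ₚ, xᵀ A x = 0}`. -/
def Vfeas (N : ℕ) (Ap : Set (Matrix (Fin N) (Fin N) ℝ)) : Set (Fin N → ℝ) :=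
  {x | x ⬝ᵥ A0 N *ᵥ x = 1 ∧ ∀ A ∈ Ap, x ⬝ᵥ A *ᵥ x = 0}

/-- The QCQP optimal value `q⋆ = inf {xᵀ Q x : x ∈ V}`. -/
def qcqpVal (N : ℕ) (Q : Matrix (Fin N) (Fin N) ℝ)
    (Ap : Set (Matrix (Fin N) (Fin N) ℝ)) : ℝ :=
  sInf ((fun x => x ⬝ᵥ Q *ᵥ x) '' Vfeas N Ap)

/-- The SDP feasible set
`F(𝒜) = {X ⪰ 0 : ⟨A₀, X⟩ = 1 ∧ ∀ A ∈ 𝒜, ⟨A, X⟩ = 0}` (Frobenius inner product);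
note that `X.PosSemidef` includes the symmetry of `X`. -/
def Fset (N : ℕ) (𝒜 : Set (Matrix (Fin N) (Fin N) ℝ)) :
    Set (Matrix (Fin N) (Fin N) ℝ) :=
  {X | X.PosSemidef ∧ ((A0 N)ᵀ * X).trace = 1 ∧ ∀ A ∈ 𝒜, (Aᵀ * X).trace = 0}

/-- The SDP optimal value `p(𝒜) = inf {⟨Q, X⟩ : X ∈ F(𝒜)}`. -/
def sdpVal (N : ℕ) (Q : Matrix (Fin N) (Fin N) ℝ)
    (𝒜 : Set (Matrix (Fin N) (Fin N) ℝ)) : ℝ :=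
  sInf ((fun X => (Qᵀ * X).trace) '' Fset N 𝒜)

/-- The learned constraint set `𝒜ₗ = {A symmetric : ∀ x ∈ V, xᵀ A x = 0}`. -/
def Alearned (N : ℕ) (Ap : Set (Matrix (Fin N) (Fin N) ℝ)) :
    Set (Matrix (Fin N) (Fin N) ℝ) :=
  {A | A.IsSymm ∧ ∀ x ∈ Vfeas N Ap, x ⬝ᵥ A *ᵥ x = 0}

theorem Matrix.exists_eq_vecMulVec_of_rank_eq_one {m n K : Type*} [Fintype n] [DecidableEq n]
    [Finite m] [Field K] {X : Matrix m n K} (h : X.rank = 1) :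
    ∃ (u : m → K) (v : n → K), X = vecMulVec u v := by
  obtain ⟨u, -, hu⟩ := finrank_eq_one_iff'.1 h
  choose c hc using fun j => hu ⟨X *ᵥ Pi.single j 1, Pi.single j 1, rfl⟩
  refine ⟨u, c, ?_⟩
  ext i j
  have := congrFun (congrArg Subtype.val (hc j)) i
  simp only [Submodule.coe_smul, Pi.smul_apply, smul_eq_mul, mulVec_single_one, col_apply] at this
  rw [vecMulVec_apply, mul_comm, this]

theorem Matrix.IsSymm.eq_vecMulVec_col_of_rank_eq_one {n K : Type*} [Fintype n] [DecidableEq n]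
    [Field K] {X : Matrix n n K} (hX : X.IsSymm) (h : X.rank = 1) {k : n} (hk : X k k = 1) :
    X = vecMulVec (X.col k) (X.col k) := by
  obtain ⟨u, v, huv⟩ := exists_eq_vecMulVec_of_rank_eq_one h
  have entry (i j : n) : X i j = u i * v j := by rw [huv, vecMulVec_apply]
  ext i j
  have hj := hX.apply k j
  rw [entry, entry] at hj
  rw [entry] at hk
  simp only [vecMulVec_apply, col_apply, entry]
  linear_combination (-u i * v j) * hk - (u i * v k) * hj

theorem trace_transpose_mul_vecMulVec_self {n R : Type*} [Fintype n] [CommSemiring R]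
    (A : Matrix n n R) (x : n → R) :
    (Aᵀ * vecMulVec x x).trace = x ⬝ᵥ A *ᵥ x := by
  rw [mul_vecMulVec, trace_vecMulVec, mulVec_transpose, dotProduct_mulVec]

theorem trace_A0_transpose_mul {N : ℕ} (hN : 0 < N) (X : Matrix (Fin N) (Fin N) ℝ) :
    ((A0 N)ᵀ * X).trace = X ⟨0, hN⟩ ⟨0, hN⟩ := by
  have hz (i : Fin N) : (i : ℕ) = 0 ↔ i = ⟨0, hN⟩ := by simp [Fin.ext_iff]
  simp [trace, mul_apply, A0, hz]

theorem Fset_antitone (N : ℕ) : Antitone (Fset N) :=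
  fun _ _ h _ hX => ⟨hX.1, hX.2.1, fun A hA => hX.2.2 A (h hA)⟩

theorem vecMulVec_self_mem_Fset_Alearned {N : ℕ} {Ap : Set (Matrix (Fin N) (Fin N) ℝ)}
    {x : Fin N → ℝ} (hx : x ∈ Vfeas N Ap) : vecMulVec x x ∈ Fset N (Alearned N Ap) := by
  refine ⟨by simpa using posSemidef_vecMulVec_self_star x, ?_, fun A hA => ?_⟩
  · rw [trace_transpose_mul_vecMulVec_self, hx.1]
  · rw [trace_transpose_mul_vecMulVec_self, hA.2 x hx]

theorem mem_Vfeas_of_vecMulVec_self_mem_Fset {N : ℕ} {Ap : Set (Matrix (Fin N) (Fin N) ℝ)}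
    {x : Fin N → ℝ} (hx : vecMulVec x x ∈ Fset N Ap) : x ∈ Vfeas N Ap := by
  refine ⟨?_, fun A hA => ?_⟩
  · rw [← trace_transpose_mul_vecMulVec_self, hx.2.1]
  · rw [← trace_transpose_mul_vecMulVec_self, hx.2.2 A hA]

/-- **Completeness of AutoTight, rank part.** Let `𝒜ₖ` be a set of
valid constraints for `V` containing the primary constraints `𝒜ₚ`, with `V`
nonempty and the SDP objective bounded below on `F(𝒜ₖ)`. If `Xₖ⋆ ∈ F(𝒜ₖ)` is
optimal (`⟨Q, Xₖ⋆⟩ = p(𝒜ₖ)`) with `rank Xₖ⋆ = 1`, then `Xₖ⋆ ∈ F(𝒜ₗ)` and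
`⟨Q, Xₖ⋆⟩ = p(𝒜ₗ) = p(𝒜ₖ) = q⋆`; in particular the SDP with the learned
constraints `𝒜ₗ` admits a rank-one optimal solution. -/
theorem statement12 (N : ℕ) (hN : 1 ≤ N)
    (Ap : Set (Matrix (Fin N) (Fin N) ℝ))
    (Q : Matrix (Fin N) (Fin N) ℝ) (hQ : Q.IsSymm)
    (Ak : Set (Matrix (Fin N) (Fin N) ℝ))
    (hApAk : Ap ⊆ Ak) (hAk : Ak ⊆ Alearned N Ap)
    (hV : (Vfeas N Ap).Nonempty)
    (hbdd : BddBelow ((fun X => (Qᵀ * X).trace) '' Fset N Ak))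
    (Xk : Matrix (Fin N) (Fin N) ℝ) (hXk : Xk ∈ Fset N Ak)
    (hopt : (Qᵀ * Xk).trace = sdpVal N Q Ak)
    (hrank : Xk.rank = 1) :
    Xk ∈ Fset N (Alearned N Ap) ∧
    (Qᵀ * Xk).trace = sdpVal N Q (Alearned N Ap) ∧
    sdpVal N Q (Alearned N Ap) = sdpVal N Q Ak ∧
    sdpVal N Q Ak = qcqpVal N Q Ap ∧
    ∃ X ∈ Fset N (Alearned N Ap),
      X.rank = 1 ∧ (Qᵀ * X).trace = sdpVal N Q (Alearned N Ap) := by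
  have hsymm : Xk.IsSymm := by simpa [IsHermitian, IsSymm] using hXk.1.isHermitian
  have hcorner := hXk.2.1
  rw [trace_A0_transpose_mul hN] at hcorner
  obtain ⟨x, hx⟩ : ∃ x, Xk = vecMulVec x x :=
    ⟨_, hsymm.eq_vecMulVec_col_of_rank_eq_one hrank hcorner⟩
  have hxV : x ∈ Vfeas N Ap :=
    mem_Vfeas_of_vecMulVec_self_mem_Fset (hx ▸ Fset_antitone N hApAk hXk)
  have hXl : Xk ∈ Fset N (Alearned N Ap) := hx ▸ vecMulVec_self_mem_Fset_Alearned hxV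
  have hle : ∀ X ∈ Fset N Ak, (Qᵀ * Xk).trace ≤ (Qᵀ * X).trace := fun X hX =>
    hopt.trans_le (csInf_le hbdd ⟨X, hX, rfl⟩)
  have hl : sdpVal N Q (Alearned N Ap) = (Qᵀ * Xk).trace := by
    refine IsLeast.csInf_eq ⟨⟨Xk, hXl, rfl⟩, ?_⟩
    rintro _ ⟨X, hX, rfl⟩
    exact hle X (Fset_antitone N hAk hX)
  have hq : qcqpVal N Q Ap = (Qᵀ * Xk).trace := by
    refine IsLeast.csInf_eq ⟨⟨x, hxV, ?_⟩, ?_⟩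
    · rw [hx, trace_transpose_mul_vecMulVec_self]
    · rintro _ ⟨y, hy, rfl⟩
      have := hle _ (Fset_antitone N hAk (vecMulVec_self_mem_Fset_Alearned hy))
      rwa [trace_transpose_mul_vecMulVec_self Q y] at this
  exact ⟨hXl, hl.symm, hl.trans hopt, hopt.symm.trans hq.symm, Xk, hXl, hrank, hl.symm⟩
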